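/- Let μ, ν ∈ ℝ with μ > −2, μ+ν > −2 and μ−ν > −2. Then for every j ∈ ℕ₀: ∫_0^∞ Λ_{2,j}^{μ,ν}(x)·x^{μ+1} dx = (−1)^j·2^μ·Γ(j+(μ−ν+2)/2)/j! and ∫_0^∞ Λ_{2,j}^{μ,ν}(x)·x^{μ+ν+1} dx = (−1)^j·2^{μ+ν}·Γ(j+(μ+ν+2)/2)/j!. -/

import Mathlib

noncomputable section

open Set MeasureTheory Filter Topology

/-- The Euler operator `θ = x·d/dx` acting on real-valued functions on `ℝ`. -/
def eulerOp (u : ℝ → ℝ) : ℝ → ℝ := fun x => x * deriv u x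

/-- The operator `(θ + a)(θ + b) − x²` applied to `v`. -/
def quadOp (a b : ℝ) (v : ℝ → ℝ) : ℝ → ℝ := fun x =>
  eulerOp (fun y => eulerOp v y + b * v y) x
    + a * (eulerOp v x + b * v x) - x ^ 2 * v x

/-- The fourth-order operator `D_{μ,ν} = x⁻²((θ+μ+ν)(θ+μ) − x²)(θ(θ+ν) − x²)`. -/
def Dop (μ ν : ℝ) (u : ℝ → ℝ) : ℝ → ℝ := fun x =>
  quadOp (μ + ν) μ (quadOp 0 ν u) x / x ^ 2

/-- The normalized I-Bessel function `Ĩ_α(z) = Σ (z/2)^{2n}/(n!·Γ(n+α+1))`. -/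
def tildeI (α z : ℝ) : ℝ :=
  ∑' n : ℕ, (z / 2) ^ (2 * n) / ((n.factorial : ℝ) * Real.Gamma ((n : ℝ) + α + 1))

/-- The K-Bessel function `K_α(z) = ∫₀^∞ e^{−z·cosh s}·cosh(α·s) ds`. -/
def besselK (α z : ℝ) : ℝ :=
  ∫ s in Ioi (0 : ℝ), Real.exp (-z * Real.cosh s) * Real.cosh (α * s)

/-- The normalized K-Bessel function `K̃_α(z) = (z/2)^{−α}·K_α(z)`. -/
def tildeK (α z : ℝ) : ℝ := (z / 2) ^ (-α) * besselK α z

/-- The generating function `G₁^{μ,ν}(t,x)`. -/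
def genG₁ (μ ν t x : ℝ) : ℝ :=
  (1 - t) ^ (-(μ + ν + 2) / 2) * tildeI (μ / 2) (t * x / (1 - t)) * tildeI (ν / 2) (x / (1 - t))

/-- The generating function `G₂^{μ,ν}(t,x)`. -/
def genG₂ (μ ν t x : ℝ) : ℝ :=
  (1 - t) ^ (-(μ + ν + 2) / 2) * tildeI (μ / 2) (t * x / (1 - t)) * tildeK (ν / 2) (x / (1 - t))

/-- The generating function `G₃^{μ,ν}(t,x)`. -/
def genG₃ (μ ν t x : ℝ) : ℝ :=
  (1 - t) ^ (-(μ + ν + 2) / 2) * tildeK (μ / 2) (t * x / (1 - t)) * tildeI (ν / 2) (x / (1 - t))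

/-- The generating function `G₄^{μ,ν}(t,x)`. -/
def genG₄ (μ ν t x : ℝ) : ℝ :=
  (1 - t) ^ (-(μ + ν + 2) / 2) * tildeK (μ / 2) (t * x / (1 - t)) * tildeK (ν / 2) (x / (1 - t))

/-- `Λ₁ⱼ^{μ,ν}(x) = (1/j!)·(∂/∂t)^j|₀ G₁^{μ,ν}(t,x)`. -/
def Lambda₁ (μ ν : ℝ) (j : ℕ) (x : ℝ) : ℝ :=
  iteratedDeriv j (fun t => genG₁ μ ν t x) 0 / (j.factorial : ℝ)

/-- `Λ₂ⱼ^{μ,ν}(x) = (1/j!)·(∂/∂t)^j|₀ G₂^{μ,ν}(t,x)`. -/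
def Lambda₂ (μ ν : ℝ) (j : ℕ) (x : ℝ) : ℝ :=
  iteratedDeriv j (fun t => genG₂ μ ν t x) 0 / (j.factorial : ℝ)

/-- `Λ₁ⱼ` for integer `j`, vanishing for `j < 0`. -/
def Lambda₁Z (μ ν : ℝ) (j : ℤ) (x : ℝ) : ℝ :=
  if 0 ≤ j then Lambda₁ μ ν j.toNat x else 0

/-- `Λ₂ⱼ` for integer `j`, vanishing for `j < 0`. -/
def Lambda₂Z (μ ν : ℝ) (j : ℤ) (x : ℝ) : ℝ :=
  if 0 ≤ j then Lambda₂ μ ν j.toNat x else 0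

/-- For `μ = m` a positive odd integer, `Λ₃ⱼ^{μ,ν}(x) = (1/(j+μ)!)·(∂/∂t)^{j+μ}|₀ [tᵐ·G₃]`,
the derivative at `0` being the limit from the right of the `(j+μ)`-th derivative of the
real-analytic function `t ↦ tᵐ·G₃^{m,ν}(t,x)` on `(0,1)`; it vanishes for `j < −μ`. -/
def Lambda₃ (m : ℕ) (ν : ℝ) (j : ℤ) (x : ℝ) : ℝ :=
  if -(m : ℤ) ≤ j then
    limUnder (𝓝[>] (0 : ℝ))
        (fun t => iteratedDeriv (j + (m : ℤ)).toNat (fun s => s ^ m * genG₃ (m : ℝ) ν s x) t) /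
      (((j + (m : ℤ)).toNat.factorial : ℝ))
  else 0

/-- For `μ = m` a positive odd integer, `Λ₄ⱼ^{μ,ν}(x) = (1/(j+μ)!)·(∂/∂t)^{j+μ}|₀ [tᵐ·G₄]`,
vanishing for `j < −μ`. -/
def Lambda₄ (m : ℕ) (ν : ℝ) (j : ℤ) (x : ℝ) : ℝ :=
  if -(m : ℤ) ≤ j then
    limUnder (𝓝[>] (0 : ℝ))
        (fun t => iteratedDeriv (j + (m : ℤ)).toNat (fun s => s ^ m * genG₄ (m : ℝ) ν s x) t) /
      (((j + (m : ℤ)).toNat.factorial : ℝ))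
  else 0

section ParametricIntegral

variable {Ω : Type*} [MeasurableSpace Ω] {m : Measure Ω}

/-- A family of functions of `ω`, holomorphic in the parameter on the disc of radius `r` and
dominated there by an integrable function `g`. -/
structure DominatedHolomorphic (m : Measure Ω) (F : ℂ → Ω → ℂ) (g : Ω → ℝ) (r : ℝ) : Prop where
  radius_pos : 0 < r
  measurable : ∀ t ∈ Metric.ball (0 : ℂ) r, AEStronglyMeasurable (F t) m
  differentiableOn : ∀ᵐ ω ∂m, DifferentiableOn ℂ (fun t => F t ω) (Metric.ball 0 r)
  bound : ∀ᵐ ω ∂m, ∀ t ∈ Metric.ball (0 : ℂ) r, ‖F t ω‖ ≤ g ω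
  integrable_bound : Integrable g m

namespace DominatedHolomorphic

variable {F : ℂ → Ω → ℂ} {g : Ω → ℝ} {r : ℝ}

lemma integrable (h : DominatedHolomorphic m F g r) {t : ℂ} (ht : t ∈ Metric.ball (0 : ℂ) r) :
    Integrable (F t) m :=
  h.integrable_bound.mono' (h.measurable t ht) (h.bound.mono fun _ hω => hω t ht)

lemma deriv_family (h : DominatedHolomorphic m F g r) :
    DominatedHolomorphic m (fun t ω => deriv (fun s => F s ω) t) (fun ω => g ω / (r / 4))
      (r / 2) := by
  have hr := h.radius_pos
  have hsub : Metric.ball (0 : ℂ) (r / 2) ⊆ Metric.ball 0 r :=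
    Metric.ball_subset_ball (by linarith)
  refine ⟨by linarith, fun t ht => ?_, ?_, ?_, h.integrable_bound.div_const _⟩
  · have ht' : ‖t‖ < r / 2 := by simpa using ht
    let ε : ℕ → ℂ := fun n => ((r / 2 * (1 / ((n : ℝ) + 1)) : ℝ) : ℂ)
    have hε0 : Tendsto ε atTop (𝓝 0) := by
      have : Tendsto (fun n : ℕ => r / 2 * (1 / ((n : ℝ) + 1))) atTop (𝓝 (r / 2 * 0)) :=
        tendsto_one_div_add_atTop_nhds_zero_nat.const_mul _
      rw [mul_zero] at this
      simpa only [Complex.ofReal_zero] using! (Complex.continuous_ofReal.tendsto 0).comp this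
    have hεne : ∀ n, ε n ≠ 0 := fun n => by
      have : 0 < r / 2 * (1 / ((n : ℝ) + 1)) := by positivity
      exact Complex.ofReal_ne_zero.2 this.ne'
    have hεt : Tendsto ε atTop (𝓝[≠] 0) :=
      tendsto_nhdsWithin_iff.2 ⟨hε0, Eventually.of_forall hεne⟩
    have hεr : ∀ n, ‖ε n‖ ≤ r / 2 := fun n => by
      simp only [ε, Complex.norm_real, Real.norm_eq_abs]
      rw [abs_of_pos (by positivity)]
      have : 1 / ((n : ℝ) + 1) ≤ 1 := by
        rw [div_le_one (by positivity)]; linarith [n.cast_nonneg (α := ℝ)]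
      nlinarith
    refine aestronglyMeasurable_of_tendsto_ae atTop
      (f := fun n ω => (ε n)⁻¹ • (F (t + ε n) ω - F t ω)) (fun n => ?_) ?_
    · refine AEStronglyMeasurable.const_smul ((h.measurable (t + ε n) ?_).sub (h.measurable t (hsub ht))) (ε n)⁻¹
      rw [mem_ball_zero_iff]
      linarith [norm_add_le t (ε n), hεr n]
    · filter_upwards [h.differentiableOn] with ω hω
      exact ((hω.differentiableAt
        (Metric.isOpen_ball.mem_nhds (hsub ht))).hasDerivAt.tendsto_slope_zero).comp hεt
  · filter_upwards [h.differentiableOn] with ω hω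
    exact (hω.deriv Metric.isOpen_ball).mono hsub
  · filter_upwards [h.differentiableOn, h.bound] with ω hω hb t ht
    have ht' : ‖t‖ < r / 2 := by simpa using ht
    have hcl : Metric.closedBall t (r / 4) ⊆ Metric.ball 0 r := fun z hz => by
      rw [mem_ball_zero_iff]
      rw [mem_closedBall_iff_norm] at hz
      have := norm_add_le (z - t) t
      rw [sub_add_cancel] at this
      linarith
    refine Complex.norm_deriv_le_of_forall_mem_sphere_norm_le (by linarith)
      (DifferentiableOn.diffContOnCl (hω.mono ?_)) fun z hz =>
        hb z (hcl (Metric.sphere_subset_closedBall hz))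
    rw [closure_ball _ (by linarith)]
    exact hcl

lemma hasDerivAt_integral (h : DominatedHolomorphic m F g r) {t : ℂ}
    (ht : t ∈ Metric.ball (0 : ℂ) (r / 2)) :
    HasDerivAt (fun t => ∫ ω, F t ω ∂m) (∫ ω, deriv (fun s => F s ω) t ∂m) t := by
  have hr := h.radius_pos
  have hsub : Metric.ball (0 : ℂ) (r / 2) ⊆ Metric.ball 0 r :=
    Metric.ball_subset_ball (by linarith)
  have h' := h.deriv_family
  refine (hasDerivAt_integral_of_dominated_loc_of_deriv_le
    (Metric.isOpen_ball.mem_nhds ht) ?_ (h.integrable (hsub ht)) (h'.measurable t ht)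
    h'.bound h'.integrable_bound ?_).2
  · filter_upwards [Metric.isOpen_ball.mem_nhds (hsub ht)] with s hs using h.measurable s hs
  · filter_upwards [h.differentiableOn] with ω hω s hs
    exact (hω.differentiableAt (Metric.isOpen_ball.mem_nhds (hsub hs))).hasDerivAt

lemma analyticAt_integral (h : DominatedHolomorphic m F g r) :
    AnalyticAt ℂ (fun t => ∫ ω, F t ω ∂m) 0 := by
  have hr := h.radius_pos
  refine DifferentiableOn.analyticAt (s := Metric.ball 0 (r / 2)) (fun t ht =>
    (h.hasDerivAt_integral ht).differentiableAt.differentiableWithinAt) ?_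
  exact Metric.ball_mem_nhds _ (by linarith)

lemma integrable_iteratedDeriv (h : DominatedHolomorphic m F g r) (j : ℕ) :
    Integrable (fun ω => iteratedDeriv j (fun t => F t ω) 0) m := by
  induction j generalizing F g r with
  | zero => simpa using h.integrable (Metric.mem_ball_self h.radius_pos)
  | succ j ih => simpa only [iteratedDeriv_succ'] using ih h.deriv_family

lemma iteratedDeriv_integral (h : DominatedHolomorphic m F g r) (j : ℕ) :
    iteratedDeriv j (fun t => ∫ ω, F t ω ∂m) 0 = ∫ ω, iteratedDeriv j (fun t => F t ω) 0 ∂m := by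
  induction j generalizing F g r with
  | zero => simp
  | succ j ih =>
    have hr := h.radius_pos
    simp only [iteratedDeriv_succ']
    have heq : deriv (fun t => ∫ ω, F t ω ∂m) =ᶠ[𝓝 0]
        fun t => ∫ ω, deriv (fun s => F s ω) t ∂m := by
      filter_upwards [Metric.ball_mem_nhds (0 : ℂ) (half_pos hr)] with t ht
      exact (h.hasDerivAt_integral ht).deriv
    rw [heq.iteratedDeriv_eq]
    exact ih h.deriv_family

end DominatedHolomorphic

end ParametricIntegral

lemma iteratedDeriv_re_of_analyticAt {f : ℝ → ℝ} {F : ℂ → ℂ} (hF : AnalyticAt ℂ F 0)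
    (hf : f =ᶠ[𝓝 0] fun t : ℝ => (F t).re) (j : ℕ) :
    iteratedDeriv j f 0 = (iteratedDeriv j F 0).re := by
  induction j generalizing f F with
  | zero => simpa using hf.eq_of_nhds
  | succ j ih =>
    rw [iteratedDeriv_succ', iteratedDeriv_succ']
    refine ih hF.deriv ?_
    have hev : ∀ᶠ t : ℝ in 𝓝 0, AnalyticAt ℂ F (t : ℂ) :=
      (Complex.continuous_ofReal.tendsto' (0 : ℝ) (0 : ℂ) Complex.ofReal_zero).eventually
        hF.eventually_analyticAt
    filter_upwards [hf.eventuallyEq_nhds, hev] with t ht hFt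
    rw [ht.deriv_eq]
    exact hFt.differentiableAt.hasDerivAt.real_of_complex.deriv

lemma iteratedDeriv_Gamma_mul_one_add_rpow {a : ℝ} (ha : 0 < a) (j : ℕ) :
    iteratedDeriv j (fun t : ℝ => Real.Gamma a * (1 + t) ^ (-a)) 0
      = (-1) ^ j * Real.Gamma (j + a) := by
  induction j generalizing a with
  | zero => simp
  | succ j ih =>
    have hd : deriv (fun t : ℝ => Real.Gamma a * (1 + t) ^ (-a))
        = fun t => -(Real.Gamma (a + 1) * (1 + t) ^ (-(a + 1))) := by
      funext t
      rw [deriv_const_mul_field, deriv_comp_const_add (fun x : ℝ => x ^ (-a)) 1 t,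
        Real.deriv_rpow_const, Real.Gamma_add_one ha.ne', neg_add']
      ring
    rw [iteratedDeriv_succ', hd, iteratedDeriv_fun_neg, ih (by linarith)]
    push_cast
    rw [add_assoc (j : ℝ) 1 a, add_comm 1 a]
    ring

/-- The normalized I-Bessel function of a complex argument. -/
def complexTildeI (β : ℝ) (w : ℂ) : ℂ :=
  ∑' n : ℕ, (w / 2) ^ (2 * n) / (((n.factorial : ℝ) * Real.Gamma ((n : ℝ) + β + 1) : ℝ) : ℂ)

lemma complexTildeI_ofReal (β x : ℝ) : complexTildeI β x = (tildeI β x : ℂ) := by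
  rw [complexTildeI, tildeI, Complex.ofReal_tsum]
  push_cast
  rfl

lemma exists_Gamma_lower_bound {β : ℝ} (hβ : -1 < β) :
    ∃ c > 0, ∀ n : ℕ, c * n.factorial / 2 ^ n ≤ Real.Gamma ((n : ℝ) + β + 1) := by
  have h0 : 0 < Real.Gamma (β + 1) := Real.Gamma_pos_of_pos (by linarith)
  have h1 : 0 < Real.Gamma (β + 2) := Real.Gamma_pos_of_pos (by linarith)
  refine ⟨min (Real.Gamma (β + 1)) (Real.Gamma (β + 2)), lt_min h0 h1, fun n => ?_⟩
  set c := min (Real.Gamma (β + 1)) (Real.Gamma (β + 2)) with hc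
  have hcpos : 0 < c := lt_min h0 h1
  rcases n with _ | n
  · have : c ≤ Real.Gamma (β + 1) := min_le_left _ _
    simpa using this
  induction n with
  | zero =>
    have : c ≤ Real.Gamma (β + 2) := min_le_right _ _
    have e : ((0 + 1 : ℕ) : ℝ) + β + 1 = β + 2 := by push_cast; ring
    rw [e]
    simp
    linarith
  | succ n ih =>
    have e : ((n + 1 + 1 : ℕ) : ℝ) + β + 1 = (((n + 1 : ℕ) : ℝ) + β + 1) + 1 := by
      push_cast; ring
    have hn : (0 : ℝ) ≤ n := n.cast_nonneg
    rw [e, Real.Gamma_add_one (by push_cast; linarith), Nat.factorial_succ (n + 1), pow_succ]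
    have hP : 0 ≤ c * (n + 1).factorial / 2 ^ (n + 1) := by positivity
    calc c * ((n + 1 + 1) * (n + 1).factorial : ℕ) / (2 ^ (n + 1) * 2)
        = ((n : ℝ) + 2) / 2 * (c * (n + 1).factorial / 2 ^ (n + 1)) := by push_cast; field_simp; ring
      _ ≤ (((n + 1 : ℕ) : ℝ) + β + 1) * Real.Gamma (((n + 1 : ℕ) : ℝ) + β + 1) := by
          refine mul_le_mul ?_ ih hP ?_ <;> push_cast <;> linarith

lemma exists_tildeI_term_bound {β : ℝ} (hβ : -1 < β) :
    ∃ C > 0, ∀ (w : ℂ) (R : ℝ), ‖w‖ ≤ R → ∀ n : ℕ,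
      ‖(w / 2) ^ (2 * n) / (((n.factorial : ℝ) * Real.Gamma ((n : ℝ) + β + 1) : ℝ) : ℂ)‖
        ≤ C * Real.exp R * (R ^ n / n.factorial) := by
  obtain ⟨c, hc, hΓ⟩ := exists_Gamma_lower_bound hβ
  refine ⟨1 / c, by positivity, fun w R hw n => ?_⟩
  have hR : 0 ≤ R := (norm_nonneg w).trans hw
  have hf : (0 : ℝ) < n.factorial := by positivity
  have hG : 0 < Real.Gamma ((n : ℝ) + β + 1) :=
    Real.Gamma_pos_of_pos (by linarith [n.cast_nonneg (α := ℝ)])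
  rw [norm_div, norm_pow, norm_div, Complex.norm_real, Real.norm_of_nonneg (by positivity)]
  have hexp : R ^ n / n.factorial ≤ Real.exp R := Real.pow_div_factorial_le_exp R hR n
  calc (‖w‖ / ‖(2 : ℂ)‖) ^ (2 * n) / (n.factorial * Real.Gamma ((n : ℝ) + β + 1))
      ≤ (R / 2) ^ (2 * n) / (n.factorial * (c * n.factorial / 2 ^ n)) := by
        rw [Complex.norm_ofNat]
        gcongr
        exact hΓ n
    _ = 1 / c * (R ^ n / n.factorial) * (R ^ n / n.factorial) * (1 / 2) ^ n := by
        rw [pow_mul, div_pow, show (2 : ℝ) ^ 2 = 2 * 2 by norm_num, div_pow, mul_pow, one_div_pow]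
        field_simp
        ring
    _ ≤ 1 / c * Real.exp R * (R ^ n / n.factorial) * 1 := by
        gcongr
        exact pow_le_one₀ (by norm_num) (by norm_num)
    _ = _ := mul_one _

lemma summable_tildeI_bound (C R : ℝ) :
    Summable fun n : ℕ => C * Real.exp R * (R ^ n / (n.factorial : ℝ)) :=
  (Real.summable_pow_div_factorial R).mul_left _

lemma differentiable_complexTildeI {β : ℝ} (hβ : -1 < β) :
    Differentiable ℂ (complexTildeI β) := by
  obtain ⟨C, _, hb⟩ := exists_tildeI_term_bound hβ
  intro w
  have hd : DifferentiableOn ℂ (complexTildeI β) (Metric.ball 0 (‖w‖ + 1)) := by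
    refine Complex.differentiableOn_tsum_of_summable_norm (summable_tildeI_bound C (‖w‖ + 1))
      (fun n => ?_) Metric.isOpen_ball (fun n z hz => hb z _ ?_ n)
    · exact (((differentiable_id.div_const 2).pow (2 * n)).div_const _).differentiableOn
    · rw [mem_ball_zero_iff] at hz
      exact hz.le
  exact hd.differentiableAt (Metric.isOpen_ball.mem_nhds (by simp))

lemma exists_complexTildeI_bound {β : ℝ} (hβ : -1 < β) :
    ∃ C > 0, ∀ w : ℂ, ‖complexTildeI β w‖ ≤ C * Real.exp (2 * ‖w‖) := by
  obtain ⟨C, hC, hb⟩ := exists_tildeI_term_bound hβ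
  refine ⟨C, hC, fun w => ?_⟩
  have hsum : ∑' n : ℕ, C * Real.exp ‖w‖ * (‖w‖ ^ n / (n.factorial : ℝ))
      = C * Real.exp (2 * ‖w‖) := by
    rw [tsum_mul_left, (NormedSpace.expSeries_div_hasSum_exp ‖w‖).tsum_eq, ← Real.exp_eq_exp_ℝ,
      mul_assoc, ← Real.exp_add, two_mul]
  rw [← hsum]
  exact tsum_of_norm_bounded (summable_tildeI_bound C ‖w‖).hasSum (hb w ‖w‖ le_rfl)

lemma summable_tildeI {β : ℝ} (hβ : -1 < β) (x : ℝ) :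
    Summable fun n : ℕ =>
      (x / 2) ^ (2 * n) / ((n.factorial : ℝ) * Real.Gamma ((n : ℝ) + β + 1)) := by
  obtain ⟨C, _, hb⟩ := exists_tildeI_term_bound hβ
  have := Summable.of_norm_bounded (summable_tildeI_bound C ‖(x : ℂ)‖) (hb x _ le_rfl)
  rw [← Complex.summable_ofReal]
  exact_mod_cast this

lemma tildeI_nonneg {β : ℝ} (hβ : -1 < β) (x : ℝ) : 0 ≤ tildeI β x := by
  refine tsum_nonneg fun n => ?_
  have : 0 < Real.Gamma ((n : ℝ) + β + 1) :=
    Real.Gamma_pos_of_pos (by linarith [n.cast_nonneg (α := ℝ)])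
  rw [pow_mul]
  positivity

lemma continuous_tildeI {β : ℝ} (hβ : -1 < β) : Continuous (tildeI β) := by
  have h : tildeI β = fun x : ℝ => (complexTildeI β x).re := by
    funext x
    rw [complexTildeI_ofReal, Complex.ofReal_re]
  rw [h]
  exact Complex.continuous_re.comp
    ((differentiable_complexTildeI hβ).continuous.comp Complex.continuous_ofReal)

lemma lintegral_eq_lintegral_Ioi_add_comp_neg (f : ℝ → ENNReal) :
    ∫⁻ s, f s = (∫⁻ s in Ioi (0 : ℝ), f s) + ∫⁻ s in Ioi (0 : ℝ), f (-s) := by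
  rw [← lintegral_add_compl f (measurableSet_Ioi (a := (0 : ℝ))), compl_Ioi,
    ← restrict_Iio_eq_restrict_Iic]
  congr 1
  have h := lintegral_image_eq_lintegral_abs_deriv_mul (f := fun s : ℝ => -s) (f' := fun _ => -1)
    (measurableSet_Ioi (a := (0 : ℝ))) (fun x _ => (hasDerivAt_neg x).hasDerivWithinAt)
    neg_injective.injOn f
  simpa using h

lemma lintegral_exp_neg_mul_cosh {z : ℝ} (hz : 0 < z) (α : ℝ) :
    ∫⁻ s in Ioi (0 : ℝ), ENNReal.ofReal (Real.exp (-(z * Real.cosh s)) * Real.cosh (α * s))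
      = ENNReal.ofReal ((z / 2) ^ α / 2) *
        ∫⁻ u in Ioi (0 : ℝ), ENNReal.ofReal (Real.exp (-u - z ^ 2 / (4 * u)) * u ^ (-α - 1)) := by
  have hz2 : 0 < z / 2 := by positivity
  have himg : (fun s : ℝ => z / 2 * Real.exp s) '' univ = Ioi 0 := by
    ext u
    simp only [image_univ, mem_range, mem_Ioi]
    refine ⟨fun ⟨s, hs⟩ => hs ▸ by positivity, fun hu => ⟨Real.log (u / (z / 2)), ?_⟩⟩
    rw [Real.exp_log (by positivity)]
    field_simp
  have hsub := lintegral_image_eq_lintegral_abs_deriv_mul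
    (f := fun s : ℝ => z / 2 * Real.exp s) (f' := fun s => z / 2 * Real.exp s)
    MeasurableSet.univ (fun x _ => ((Real.hasDerivAt_exp x).const_mul (z / 2)).hasDerivWithinAt)
    (fun a _ b _ hab => Real.exp_injective (mul_left_cancel₀ hz2.ne' hab))
    (fun u => ENNReal.ofReal (Real.exp (-u - z ^ 2 / (4 * u)) * u ^ (-α - 1)))
  rw [himg, Measure.restrict_univ] at hsub
  have hpt : ∀ s : ℝ, ENNReal.ofReal |z / 2 * Real.exp s| *
      ENNReal.ofReal (Real.exp (-(z / 2 * Real.exp s) - z ^ 2 / (4 * (z / 2 * Real.exp s))) *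
        (z / 2 * Real.exp s) ^ (-α - 1))
      = ENNReal.ofReal ((z / 2) ^ (-α)) *
        ENNReal.ofReal (Real.exp (-(z * Real.cosh s)) * Real.exp (-(α * s))) := by
    intro s
    have hu : 0 < z / 2 * Real.exp s := by positivity
    rw [← ENNReal.ofReal_mul (abs_nonneg _), ← ENNReal.ofReal_mul (by positivity), abs_of_pos hu]
    congr 1
    have e1 : -(z / 2 * Real.exp s) - z ^ 2 / (4 * (z / 2 * Real.exp s))
        = -(z * Real.cosh s) := by
      rw [Real.cosh_eq, Real.exp_neg]
      field_simp
      ring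
    have e2 : z / 2 * Real.exp s * (z / 2 * Real.exp s) ^ (-α - 1)
        = (z / 2) ^ (-α) * Real.exp (-(α * s)) := by
      rw [Real.rpow_sub_one hu.ne', mul_div_cancel₀ _ hu.ne',
        Real.mul_rpow hz2.le (Real.exp_pos s).le, ← Real.exp_mul]
      congr 2
      ring
    rw [e1]
    linear_combination Real.exp (-(z * Real.cosh s)) * e2
  rw [lintegral_congr hpt, lintegral_const_mul' _ _ ENNReal.ofReal_ne_top,
    lintegral_eq_lintegral_Ioi_add_comp_neg, ← lintegral_add_left (by fun_prop)] at hsub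
  have hcosh : ∀ s : ℝ,
      ENNReal.ofReal (Real.exp (-(z * Real.cosh s)) * Real.exp (-(α * s))) +
        ENNReal.ofReal (Real.exp (-(z * Real.cosh (-s))) * Real.exp (-(α * -s)))
      = ENNReal.ofReal 2 *
        ENNReal.ofReal (Real.exp (-(z * Real.cosh s)) * Real.cosh (α * s)) := by
    intro s
    rw [← ENNReal.ofReal_add (by positivity) (by positivity), ← ENNReal.ofReal_mul (by norm_num),
      Real.cosh_neg, Real.cosh_eq (α * s), mul_neg, neg_neg]
    congr 1
    ring
  rw [lintegral_congr hcosh, lintegral_const_mul' _ _ ENNReal.ofReal_ne_top] at hsub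
  rw [hsub, ← mul_assoc, ← mul_assoc, ← ENNReal.ofReal_mul (by positivity),
    ← ENNReal.ofReal_mul (by positivity)]
  have h1 : (z / 2) ^ α / 2 * (z / 2) ^ (-α) * 2 = 1 := by
    rw [Real.rpow_neg hz2.le]
    have : (z / 2) ^ α ≠ 0 := (Real.rpow_pos_of_pos hz2 α).ne'
    field_simp
  rw [h1, ENNReal.ofReal_one, one_mul]

lemma lintegral_tildeI_mul_gaussian {β : ℝ} (hβ : -1 < β) {b : ℝ} (hb : 0 < b) (k : ℝ) :
    ∫⁻ x in Ioi (0 : ℝ), ENNReal.ofReal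
        (tildeI β (k * x) * (x ^ (2 * β + 1) * Real.exp (-b * x ^ (2 : ℝ))))
      = ENNReal.ofReal (b ^ (-(β + 1)) / 2 * Real.exp (k ^ 2 / (4 * b))) := by
  have hG : ∀ n : ℕ, 0 < Real.Gamma ((n : ℝ) + β + 1) := fun n =>
    Real.Gamma_pos_of_pos (by linarith [n.cast_nonneg (α := ℝ)])
  let q : ℕ → ℝ := fun n => (k ^ 2 / 4) ^ n / (n.factorial * Real.Gamma ((n : ℝ) + β + 1))
  have hq : ∀ n, 0 ≤ q n := fun n => by have := hG n; positivity
  have hterm : ∀ x ∈ Ioi (0 : ℝ), ENNReal.ofReal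
      (tildeI β (k * x) * (x ^ (2 * β + 1) * Real.exp (-b * x ^ (2 : ℝ))))
      = ∑' n : ℕ, ENNReal.ofReal (q n) *
        ENNReal.ofReal (x ^ (2 * (n : ℝ) + 2 * β + 1) * Real.exp (-b * x ^ (2 : ℝ))) := by
    intro x hx
    have hx : 0 < x := hx
    have e : ∀ n : ℕ, (k * x / 2) ^ (2 * n) / (n.factorial * Real.Gamma ((n : ℝ) + β + 1)) *
        (x ^ (2 * β + 1) * Real.exp (-b * x ^ (2 : ℝ)))
        = q n * (x ^ (2 * (n : ℝ) + 2 * β + 1) * Real.exp (-b * x ^ (2 : ℝ))) := by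
      intro n
      have : x ^ (2 * (n : ℝ) + 2 * β + 1) = (x ^ 2) ^ n * x ^ (2 * β + 1) := by
        rw [add_assoc, Real.rpow_add hx, ← pow_mul, ← Real.rpow_natCast]
        push_cast
        rfl
      rw [this, pow_mul, show (k * x / 2) ^ 2 = k ^ 2 / 4 * x ^ 2 by ring, mul_pow]
      simp only [q]
      ring
    rw [tildeI, ← tsum_mul_right, tsum_congr e, ENNReal.ofReal_tsum_of_nonneg]
    · exact tsum_congr fun n => ENNReal.ofReal_mul (hq n)
    · exact fun n => mul_nonneg (hq n) (by positivity)
    · exact ((summable_tildeI hβ (k * x)).mul_right _).congr e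
  rw [setLIntegral_congr_fun measurableSet_Ioi hterm, lintegral_tsum (fun n => by fun_prop)]
  have hint : ∀ n : ℕ, ∫⁻ x in Ioi (0 : ℝ), ENNReal.ofReal (q n) *
        ENNReal.ofReal (x ^ (2 * (n : ℝ) + 2 * β + 1) * Real.exp (-b * x ^ (2 : ℝ)))
      = ENNReal.ofReal (b ^ (-(β + 1)) / 2 * ((k ^ 2 / (4 * b)) ^ n / n.factorial)) := by
    intro n
    have hn : (0 : ℝ) ≤ n := n.cast_nonneg
    have hs : -1 < 2 * (n : ℝ) + 2 * β + 1 := by linarith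
    rw [lintegral_const_mul' _ _ ENNReal.ofReal_ne_top, ← ofReal_integral_eq_lintegral_ofReal
      (integrableOn_rpow_mul_exp_neg_mul_rpow hs two_pos hb)
      ((ae_restrict_iff' measurableSet_Ioi).2 (Eventually.of_forall fun x hx => by
        have hx : 0 < x := hx
        simp only [Pi.zero_apply]; positivity)),
      integral_rpow_mul_exp_neg_mul_rpow two_pos hs hb, ← ENNReal.ofReal_mul (hq n)]
    congr 1
    have e1 : (2 * (n : ℝ) + 2 * β + 1 + 1) / 2 = n + β + 1 := by ring
    have e2 : b ^ (-(2 * (n : ℝ) + 2 * β + 1 + 1) / 2) = b ^ (-(β + 1)) / b ^ n := by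
      rw [← Real.rpow_natCast, ← Real.rpow_sub hb]
      congr 1
      ring
    have := (hG n).ne'
    rw [e1, e2, show k ^ 2 / (4 * b) = k ^ 2 / 4 / b by field_simp, div_pow (k ^ 2 / 4) b]
    simp only [q]
    field_simp
  rw [tsum_congr hint, ← ENNReal.ofReal_tsum_of_nonneg (fun n => by positivity)
    ((Real.summable_pow_div_factorial _).mul_left _), tsum_mul_left,
    (NormedSpace.expSeries_div_hasSum_exp (k ^ 2 / (4 * b))).tsum_eq, ← Real.exp_eq_exp_ℝ]

/-- The integrand, over `x, s > 0`, of the double integral which represents the moment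
`∫₀^∞ G₂^{2β,2α}(t,x)·x^{2β+1} dx`. -/
def momentKernel (α β t : ℝ) (p : ℝ × ℝ) : ℝ :=
  (1 - t) ^ (-(β + 1)) * tildeI β (t * p.1 / (1 - t)) *
    Real.exp (-(p.1 * Real.cosh p.2 / (1 - t))) *
      (2 ^ α * p.1 ^ (2 * β + 1 - α) * Real.cosh (α * p.2))

lemma momentKernel_nonneg {α β t : ℝ} (hβ : -1 < β) (ht : t < 1) {p : ℝ × ℝ} (hp : 0 < p.1) :
    0 ≤ momentKernel α β t p := by
  have := tildeI_nonneg hβ (t * p.1 / (1 - t))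
  have ht' : 0 < 1 - t := by linarith
  have := Real.cosh_pos (α * p.2)
  unfold momentKernel
  positivity

lemma lintegral_momentKernel_right {α β t x : ℝ} (hβ : -1 < β) (ht : t < 1) (hx : 0 < x) :
    ∫⁻ s in Ioi (0 : ℝ), ENNReal.ofReal (momentKernel α β t (x, s))
      = ∫⁻ u in Ioi (0 : ℝ), ENNReal.ofReal ((1 - t) ^ (-(β + 1) - α) / 2 *
          (Real.exp (-u) * u ^ (-α - 1))) * ENNReal.ofReal (tildeI β (t / (1 - t) * x) *
            (x ^ (2 * β + 1) * Real.exp (-(1 / (4 * u * (1 - t) ^ 2)) * x ^ (2 : ℝ)))) := by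
  have ht' : 0 < 1 - t := by linarith
  have hI := tildeI_nonneg hβ (t * x / (1 - t))
  set A : ℝ := (1 - t) ^ (-(β + 1)) * tildeI β (t * x / (1 - t)) *
    (2 ^ α * x ^ (2 * β + 1 - α)) with hA
  have hA0 : 0 ≤ A := by positivity
  have h1 : ∀ s : ℝ, ENNReal.ofReal (momentKernel α β t (x, s)) = ENNReal.ofReal A *
      ENNReal.ofReal (Real.exp (-(x / (1 - t) * Real.cosh s)) * Real.cosh (α * s)) := by
    intro s
    rw [← ENNReal.ofReal_mul hA0, momentKernel, hA, div_mul_eq_mul_div]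
    congr 1
    ring
  rw [lintegral_congr h1, lintegral_const_mul' _ _ ENNReal.ofReal_ne_top,
    lintegral_exp_neg_mul_cosh (by positivity), ← mul_assoc, ← ENNReal.ofReal_mul hA0,
    ← lintegral_const_mul' _ _ ENNReal.ofReal_ne_top]
  refine setLIntegral_congr_fun measurableSet_Ioi fun u hu => ?_
  have hu : 0 < u := hu
  rw [← ENNReal.ofReal_mul (by positivity), ← ENNReal.ofReal_mul (by positivity)]
  congr 1
  have e1 : (x / (1 - t) / 2) ^ α = x ^ α * (1 - t) ^ (-α) * (2 ^ α)⁻¹ := by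
    rw [Real.div_rpow (by positivity) (by norm_num), Real.div_rpow hx.le ht'.le,
      Real.rpow_neg ht'.le, div_eq_mul_inv, div_eq_mul_inv]
  have e2 : Real.exp (-u - (x / (1 - t)) ^ 2 / (4 * u))
      = Real.exp (-u) * Real.exp (-(1 / (4 * u * (1 - t) ^ 2)) * x ^ (2 : ℝ)) := by
    rw [← Real.exp_add, Real.rpow_two]
    congr 1
    field_simp
    ring
  have e3 : x ^ (2 * β + 1) = x ^ (2 * β + 1 - α) * x ^ α := by
    rw [← Real.rpow_add hx]
    congr 1
    ring
  have e4 : (1 - t) ^ (-(β + 1) - α) = (1 - t) ^ (-(β + 1)) * (1 - t) ^ (-α) := by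
    rw [← Real.rpow_add ht']
    congr 1
  have h2 : (2 : ℝ) ^ α ≠ 0 := by positivity
  rw [e1, e2, e3, e4, hA, div_mul_eq_mul_div t]
  field_simp

lemma lintegral_momentKernel {α β t : ℝ} (hβ : -1 < β) (ha : 0 < β + 1 - α) (ht : |t| < 1) :
    ∫⁻ x in Ioi (0 : ℝ), ∫⁻ s in Ioi (0 : ℝ), ENNReal.ofReal (momentKernel α β t (x, s))
      = ENNReal.ofReal (2 ^ (2 * β) *
          (Real.Gamma (β + 1 - α) * (1 + t) ^ (-(β + 1 - α)))) := by
  obtain ⟨ht1, ht2⟩ := abs_lt.1 ht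
  have htm : 0 < 1 - t := by linarith
  have htp : 0 < 1 + t := by linarith
  have hcont := continuous_tildeI hβ
  rw [setLIntegral_congr_fun measurableSet_Ioi
    (fun x hx => lintegral_momentKernel_right hβ ht2 hx),
    lintegral_lintegral_swap (by
      have := hcont.measurable
      refine Measurable.aemeasurable ?_
      simp only [Function.uncurry_def]
      fun_prop)]
  have hinner : ∀ u ∈ Ioi (0 : ℝ),
      (∫⁻ x in Ioi (0 : ℝ), ENNReal.ofReal ((1 - t) ^ (-(β + 1) - α) / 2 *
          (Real.exp (-u) * u ^ (-α - 1))) * ENNReal.ofReal (tildeI β (t / (1 - t) * x) *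
            (x ^ (2 * β + 1) * Real.exp (-(1 / (4 * u * (1 - t) ^ 2)) * x ^ (2 : ℝ)))))
      = ENNReal.ofReal (2 ^ (2 * β) * (1 - t) ^ (β + 1 - α)) *
        ENNReal.ofReal (u ^ (β + 1 - α - 1) * Real.exp (-((1 - t ^ 2) * u))) := by
    intro u hu
    have hu : 0 < u := hu
    rw [lintegral_const_mul' _ _ ENNReal.ofReal_ne_top,
      lintegral_tildeI_mul_gaussian hβ (by positivity), ← ENNReal.ofReal_mul (by positivity),
      ← ENNReal.ofReal_mul (by positivity)]
    congr 1
    have e1 : (1 / (4 * u * (1 - t) ^ 2)) ^ (-(β + 1))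
        = 4 * 2 ^ (2 * β) * u ^ (β + 1) * (1 - t) ^ (2 * β + 2) := by
      rw [one_div, Real.inv_rpow (by positivity), ← Real.rpow_neg (by positivity), neg_neg,
        Real.mul_rpow (by positivity) (by positivity), Real.mul_rpow (by norm_num) hu.le,
        ← Real.rpow_two, ← Real.rpow_mul htm.le, Real.rpow_mul (by norm_num) 2 β,
        Real.rpow_add_one (by norm_num)]
      norm_num
      ring_nf
    have e2 : Real.exp (-((1 - t ^ 2) * u))
        = Real.exp (-u) * Real.exp ((t / (1 - t)) ^ 2 / (4 * (1 / (4 * u * (1 - t) ^ 2)))) := by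
      rw [← Real.exp_add]
      congr 1
      field_simp
      ring
    have e3 : u ^ (β + 1 - α - 1) = u ^ (β + 1) * u ^ (-α - 1) := by
      rw [← Real.rpow_add hu]
      congr 1
      ring
    have e4 : (1 - t) ^ (β + 1 - α) = (1 - t) ^ (-(β + 1) - α) * (1 - t) ^ (2 * β + 2) := by
      rw [← Real.rpow_add htm]
      congr 1
      ring
    rw [e1, e2, e3, e4]
    ring
  have h1t : 0 < 1 - t ^ 2 := by nlinarith
  have hval := Real.integral_rpow_mul_exp_neg_mul_Ioi ha h1t
  have hgi : IntegrableOn (fun u : ℝ => u ^ (β + 1 - α - 1) * Real.exp (-((1 - t ^ 2) * u)))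
      (Ioi 0) := by
    refine (integrableOn_rpow_mul_exp_neg_mul_rpow (s := β + 1 - α - 1) (by linarith)
      one_pos h1t).congr_fun (fun u _ => ?_) measurableSet_Ioi
    simp only [Real.rpow_one, neg_mul]
  rw [setLIntegral_congr_fun measurableSet_Ioi hinner,
    lintegral_const_mul' _ _ ENNReal.ofReal_ne_top, ← ofReal_integral_eq_lintegral_ofReal hgi
      ((ae_restrict_iff' measurableSet_Ioi).2 (Eventually.of_forall fun u hu => by
        have hu : 0 < u := hu
        simp only [Pi.zero_apply]; positivity)), hval, ← ENNReal.ofReal_mul (by positivity)]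
  congr 1
  have e5 : (1 / (1 - t ^ 2)) ^ (β + 1 - α)
      = ((1 - t) ^ (β + 1 - α))⁻¹ * (1 + t) ^ (-(β + 1 - α)) := by
    rw [one_div, Real.inv_rpow h1t.le, show 1 - t ^ 2 = (1 - t) * (1 + t) by ring,
      Real.mul_rpow htm.le htp.le, mul_inv, Real.rpow_neg htp.le]
  have : (1 - t) ^ (β + 1 - α) ≠ 0 := (Real.rpow_pos_of_pos htm _).ne'
  rw [e5]
  field_simp

/-- Lebesgue measure on the open quadrant. -/
def quadrantMeasure : Measure (ℝ × ℝ) :=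
  (volume.restrict (Ioi (0 : ℝ))).prod (volume.restrict (Ioi (0 : ℝ)))

lemma ae_quadrantMeasure_fst_pos : ∀ᵐ p ∂quadrantMeasure, 0 < p.1 :=
  Measure.quasiMeasurePreserving_fst.ae (ae_restrict_mem measurableSet_Ioi)

/-- The extension of `momentKernel` to complex values of the parameter `t`. -/
def complexMomentKernel (α β : ℝ) (t : ℂ) (p : ℝ × ℝ) : ℂ :=
  (1 - t) ^ ((-(β + 1) : ℝ) : ℂ) * complexTildeI β (t * p.1 / (1 - t)) *
    Complex.exp (-((p.1 * Real.cosh p.2 : ℝ) / (1 - t))) *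
      ((2 ^ α * p.1 ^ (2 * β + 1 - α) * Real.cosh (α * p.2) : ℝ) : ℂ)

lemma complexMomentKernel_ofReal (α β : ℝ) {t : ℝ} (ht : t < 1) (p : ℝ × ℝ) :
    complexMomentKernel α β t p = (momentKernel α β t p : ℂ) := by
  have h : (t : ℂ) * p.1 / (1 - t) = ((t * p.1 / (1 - t) : ℝ) : ℂ) := by push_cast; rfl
  have hc : (1 - (t : ℂ)) ^ ((-(β + 1) : ℝ) : ℂ) = (((1 - t) ^ (-(β + 1)) : ℝ) : ℂ) := by
    rw [Complex.ofReal_cpow (by linarith), Complex.ofReal_sub, Complex.ofReal_one]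
  have he : Complex.exp (-((p.1 * Real.cosh p.2 : ℝ) / (1 - (t : ℂ))))
      = ((Real.exp (-(p.1 * Real.cosh p.2 / (1 - t))) : ℝ) : ℂ) := by
    push_cast
    rfl
  rw [complexMomentKernel, momentKernel, h, complexTildeI_ofReal, hc, he, ← Complex.ofReal_mul,
    ← Complex.ofReal_mul, ← Complex.ofReal_mul]

/-- The function of `x, s > 0` which, up to a constant, dominates the kernel for small `t`. -/
def kernelMajorant (α β : ℝ) (p : ℝ × ℝ) : ℝ :=
  p.1 ^ (2 * β + 1 - α) * Real.exp (-(Real.cosh p.2 / 4 * p.1)) * Real.cosh (α * p.2)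

lemma integrable_kernelMajorant {α β : ℝ} (h : |α| < 2 * β + 2 - α) :
    Integrable (kernelMajorant α β) quadrantMeasure := by
  set q := 2 * β + 2 - α with hq
  have hq0 : 0 < q := (abs_nonneg α).trans_lt h
  have hqe : 2 * β + 1 - α = q - 1 := by rw [hq]; ring
  have hmeas : Measurable (kernelMajorant α β) := by
    unfold kernelMajorant
    fun_prop
  refine (integrable_prod_iff' hmeas.aestronglyMeasurable).2
    ⟨Eventually.of_forall fun s => ?_, ?_⟩
  · have hc : 0 < Real.cosh s / 4 := by have := Real.cosh_pos s; positivity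
    have := integrableOn_rpow_mul_exp_neg_mul_rpow (s := q - 1) (by linarith) one_pos hc
    simp only [Real.rpow_one, neg_mul] at this
    simp only [kernelMajorant, hqe]
    exact this.mul_const _
  · have hval : ∀ s : ℝ, ∫ x in Ioi (0 : ℝ), ‖kernelMajorant α β (x, s)‖
        = (1 / (Real.cosh s / 4)) ^ q * Real.Gamma q * Real.cosh (α * s) := by
      intro s
      have hc : 0 < Real.cosh s / 4 := by have := Real.cosh_pos s; positivity
      rw [← Real.integral_rpow_mul_exp_neg_mul_Ioi hq0 hc, ← integral_mul_const]
      refine setIntegral_congr_fun measurableSet_Ioi fun x hx => ?_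
      have hx : 0 < x := hx
      have := Real.cosh_pos (α * s)
      simp only [kernelMajorant, hqe]
      rw [Real.norm_of_nonneg (by positivity)]
    simp only [hval]
    have hexp : IntegrableOn (fun s : ℝ => 8 ^ q * Real.Gamma q *
        Real.exp ((|α| - q) * s)) (Ioi 0) :=
      (integrableOn_exp_mul_Ioi (by linarith) 0).const_mul _
    refine Integrable.mono' hexp (Measurable.aestronglyMeasurable (by fun_prop)) ?_
    refine (ae_restrict_iff' measurableSet_Ioi).2 (Eventually.of_forall fun s hs => ?_)
    have hs : 0 < s := hs
    have hΓ := Real.Gamma_pos_of_pos hq0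
    have hc := Real.cosh_pos s
    have hc' := Real.cosh_pos (α * s)
    rw [Real.norm_of_nonneg (by positivity)]
    have e1 : Real.cosh (α * s) ≤ Real.exp (|α| * s) := by
      rw [← Real.cosh_abs, abs_mul, abs_of_pos hs, Real.cosh_eq]
      have : Real.exp (-(|α| * s)) ≤ Real.exp (|α| * s) :=
        Real.exp_le_exp.2 (by have := abs_nonneg α; nlinarith)
      linarith
    have e2 : (1 / (Real.cosh s / 4)) ^ q ≤ 8 ^ q * Real.exp (-q * s) := by
      have : (8 : ℝ) ^ q * Real.exp (-q * s) = (8 * Real.exp (-s)) ^ q := by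
        rw [Real.mul_rpow (by norm_num) (Real.exp_pos _).le, ← Real.exp_mul]
        congr 2
        ring
      rw [this]
      refine Real.rpow_le_rpow (by positivity) ?_ hq0.le
      rw [Real.exp_neg, ← div_eq_mul_inv, one_div_div, div_le_div_iff₀ hc (Real.exp_pos s),
        Real.cosh_eq]
      linarith [Real.exp_pos (-s)]
    calc (1 / (Real.cosh s / 4)) ^ q * Real.Gamma q * Real.cosh (α * s)
        ≤ 8 ^ q * Real.exp (-q * s) * Real.Gamma q * Real.exp (|α| * s) := by gcongr
      _ = 8 ^ q * Real.Gamma q * Real.exp ((|α| - q) * s) := by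
        rw [show (|α| - q) * s = -q * s + |α| * s by ring, Real.exp_add]
        ring

lemma one_sub_mem_slitPlane {t : ℂ} (ht : ‖t‖ < 1) : 1 - t ∈ Complex.slitPlane := by
  left
  have := (Complex.re_le_norm t).trans_lt ht
  simpa using this

lemma differentiableOn_complexMomentKernel {α β : ℝ} (hβ : -1 < β) (p : ℝ × ℝ) :
    DifferentiableOn ℂ (fun t => complexMomentKernel α β t p) (Metric.ball 0 (1 / 8)) := by
  intro t ht
  have ht1 : ‖t‖ < 1 := by rw [mem_ball_zero_iff] at ht; linarith
  have hs := one_sub_mem_slitPlane ht1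
  have hne : 1 - t ≠ 0 := Complex.slitPlane_ne_zero hs
  have hsub : DifferentiableAt ℂ (fun t : ℂ => 1 - t) t := by fun_prop
  refine DifferentiableAt.differentiableWithinAt ?_
  unfold complexMomentKernel
  refine (((hsub.cpow_const hs).mul ?_).mul ?_).mul_const _
  · exact (differentiable_complexTildeI hβ _).comp t
      ((differentiableAt_id.mul_const _).div hsub hne)
  · exact (((differentiableAt_const _).div hsub hne).neg).cexp

lemma measurable_complexMomentKernel {α β : ℝ} (hβ : -1 < β) (t : ℂ) :
    Measurable (complexMomentKernel α β t) := by
  have := (differentiable_complexTildeI hβ).continuous.measurable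
  unfold complexMomentKernel
  fun_prop

lemma exists_norm_complexMomentKernel_le {α β : ℝ} (hβ : -1 < β) :
    ∃ M > 0, ∀ p : ℝ × ℝ, 0 < p.1 → ∀ t ∈ Metric.ball (0 : ℂ) (1 / 8),
      ‖complexMomentKernel α β t p‖ ≤ M * kernelMajorant α β p := by
  obtain ⟨C, hC, hI⟩ := exists_complexTildeI_bound hβ
  refine ⟨(7 / 8) ^ (-(β + 1)) * C * 2 ^ α, by positivity, fun p hp t ht => ?_⟩
  rw [mem_ball_zero_iff] at ht
  have hne : 1 - t ≠ 0 := Complex.slitPlane_ne_zero (one_sub_mem_slitPlane (by linarith))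
  have hlow : 7 / 8 ≤ ‖1 - t‖ := by
    have := norm_sub_norm_le (1 : ℂ) t
    rw [norm_one] at this
    linarith
  have hupp : ‖1 - t‖ ≤ 9 / 8 := by
    have := norm_sub_le (1 : ℂ) t
    rw [norm_one] at this
    linarith
  have hcosh := Real.one_le_cosh p.2
  have hcosh' := Real.cosh_pos (α * p.2)
  have h1 : ‖(1 - t) ^ ((-(β + 1) : ℝ) : ℂ)‖ ≤ (7 / 8) ^ (-(β + 1)) := by
    rw [Complex.norm_cpow_of_ne_zero hne, Complex.ofReal_re, Complex.ofReal_im, mul_zero,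
      Real.exp_zero, div_one]
    exact Real.rpow_le_rpow_of_nonpos (by norm_num) hlow (by linarith)
  have h2 : ‖complexTildeI β (t * p.1 / (1 - t))‖ ≤ C * Real.exp (2 / 7 * p.1) := by
    refine (hI _).trans (mul_le_mul_of_nonneg_left (Real.exp_le_exp.2 ?_) hC.le)
    rw [norm_div, norm_mul, Complex.norm_real, Real.norm_of_nonneg hp.le]
    have : ‖t‖ * p.1 / ‖1 - t‖ ≤ 1 / 8 * p.1 / (7 / 8) := by gcongr
    linarith
  have h3 : ‖Complex.exp (-((p.1 * Real.cosh p.2 : ℝ) / (1 - t)))‖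
      ≤ Real.exp (-(56 / 81 * (p.1 * Real.cosh p.2))) := by
    rw [Complex.norm_exp]
    refine Real.exp_le_exp.2 ?_
    have hdiv : (((p.1 * Real.cosh p.2 : ℝ) : ℂ) / (1 - t)).re
        = p.1 * Real.cosh p.2 * ((1 - t).re / Complex.normSq (1 - t)) := by
      rw [div_eq_mul_inv, Complex.re_ofReal_mul, Complex.inv_re]
    rw [Complex.neg_re, neg_le_neg_iff, hdiv, mul_comm]
    refine mul_le_mul_of_nonneg_left ?_ (by positivity)
    rw [Complex.normSq_eq_norm_sq, le_div_iff₀ (by positivity)]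
    have hre : 7 / 8 ≤ (1 - t).re := by
      have := Complex.re_le_norm t
      rw [Complex.sub_re, Complex.one_re]
      linarith
    nlinarith
  have h4 : Real.exp (2 / 7 * p.1) * Real.exp (-(56 / 81 * (p.1 * Real.cosh p.2)))
      ≤ Real.exp (-(Real.cosh p.2 / 4 * p.1)) := by
    rw [← Real.exp_add]
    refine Real.exp_le_exp.2 ?_
    nlinarith
  rw [complexMomentKernel, norm_mul, norm_mul, norm_mul, Complex.norm_real,
    Real.norm_of_nonneg (by positivity)]
  calc _ ≤ (7 / 8) ^ (-(β + 1)) * (C * Real.exp (2 / 7 * p.1)) *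
        Real.exp (-(56 / 81 * (p.1 * Real.cosh p.2))) *
          (2 ^ α * p.1 ^ (2 * β + 1 - α) * Real.cosh (α * p.2)) := by gcongr
    _ = (7 / 8) ^ (-(β + 1)) * C * 2 ^ α * (p.1 ^ (2 * β + 1 - α) *
        (Real.exp (2 / 7 * p.1) * Real.exp (-(56 / 81 * (p.1 * Real.cosh p.2)))) *
          Real.cosh (α * p.2)) := by ring
    _ ≤ _ := by
        unfold kernelMajorant
        gcongr

lemma eventually_abs_lt_nhds_zero {r : ℝ} (hr : 0 < r) : ∀ᶠ t : ℝ in 𝓝 0, |t| < r := by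
  filter_upwards [Metric.ball_mem_nhds (0 : ℝ) hr] with t ht
  simpa using mem_ball_zero_iff.1 ht

lemma integral_momentKernel {α β t : ℝ} (hβ : -1 < β) (ha : 0 < β + 1 - α) (ht : |t| < 1) :
    ∫ p, momentKernel α β t p ∂quadrantMeasure
      = 2 ^ (2 * β) * (Real.Gamma (β + 1 - α) * (1 + t) ^ (-(β + 1 - α))) := by
  obtain ⟨ht1, ht2⟩ := abs_lt.1 ht
  have hmeas : Measurable (momentKernel α β t) := by
    have := (continuous_tildeI hβ).measurable
    unfold momentKernel
    fun_prop
  have hΓ := Real.Gamma_pos_of_pos ha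
  have h1t : 0 < 1 + t := by linarith
  rw [integral_eq_lintegral_of_nonneg_ae
    (ae_quadrantMeasure_fst_pos.mono fun p hp => momentKernel_nonneg hβ ht2 hp)
    hmeas.aestronglyMeasurable, quadrantMeasure, lintegral_prod _ (by fun_prop),
    lintegral_momentKernel hβ ha ht, ENNReal.toReal_ofReal (by positivity)]

lemma genG₂_mul_rpow_eq_integral {α β t x : ℝ} (ht : t < 1) (hx : 0 < x) :
    genG₂ (2 * β) (2 * α) t x * x ^ (2 * β + 1)
      = ∫ s in Ioi (0 : ℝ), momentKernel α β t (x, s) := by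
  have ht' : 0 < 1 - t := by linarith
  have h : ∀ s : ℝ, momentKernel α β t (x, s) = (1 - t) ^ (-(β + 1)) *
      tildeI β (t * x / (1 - t)) * (2 ^ α * x ^ (2 * β + 1 - α)) *
        (Real.exp (-(x / (1 - t)) * Real.cosh s) * Real.cosh (α * s)) := by
    intro s
    rw [momentKernel, neg_mul, div_mul_eq_mul_div]
    ring
  simp only [h]
  rw [integral_const_mul, genG₂, tildeK, besselK, mul_div_cancel_left₀ β two_ne_zero,
    mul_div_cancel_left₀ α two_ne_zero]
  have e1 : (x / (1 - t) / 2) ^ (-α) = (x ^ α)⁻¹ * (1 - t) ^ α * 2 ^ α := by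
    rw [Real.div_rpow (by positivity) (by norm_num), Real.div_rpow hx.le ht'.le,
      Real.rpow_neg ht'.le, Real.rpow_neg hx.le, Real.rpow_neg (by norm_num), div_inv_eq_mul,
      div_inv_eq_mul]
  have e2 : x ^ (2 * β + 1) = x ^ (2 * β + 1 - α) * x ^ α := by
    rw [← Real.rpow_add hx]
    congr 1
    ring
  have e3 : (1 - t) ^ (-(β + 1)) = (1 - t) ^ (-(2 * β + 2 * α + 2) / 2) * (1 - t) ^ α := by
    rw [← Real.rpow_add ht']
    congr 1
    ring
  have : x ^ α ≠ 0 := (Real.rpow_pos_of_pos hx α).ne'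
  rw [e1, e2, e3]
  field_simp

lemma dominatedHolomorphic_complexMomentKernel {α β : ℝ} (hβ : -1 < β)
    (h : |α| < 2 * β + 2 - α) :
    ∃ g, DominatedHolomorphic quadrantMeasure (complexMomentKernel α β) g (1 / 8) ∧
      ∀ᵐ x ∂volume.restrict (Ioi (0 : ℝ)), DominatedHolomorphic (volume.restrict (Ioi (0 : ℝ)))
        (fun t s => complexMomentKernel α β t (x, s)) (fun s => g (x, s)) (1 / 8) := by
  obtain ⟨M, -, hM⟩ := exists_norm_complexMomentKernel_le (α := α) hβ
  have hint := (integrable_kernelMajorant h).const_mul M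
  refine ⟨fun p => M * kernelMajorant α β p, ⟨by norm_num, fun t _ =>
    (measurable_complexMomentKernel hβ t).aestronglyMeasurable, Eventually.of_forall
      (differentiableOn_complexMomentKernel hβ), ae_quadrantMeasure_fst_pos.mono hM, hint⟩, ?_⟩
  filter_upwards [Integrable.prod_right_ae hint, ae_restrict_mem measurableSet_Ioi] with x hi hx
  exact ⟨by norm_num, fun t _ => ((measurable_complexMomentKernel hβ t).comp
    measurable_prodMk_left).aestronglyMeasurable, Eventually.of_forall
      fun s => differentiableOn_complexMomentKernel hβ (x, s), Eventually.of_forall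
        fun s => hM (x, s) hx, hi⟩

lemma integral_Lambda₂_mul_rpow {α β : ℝ} (hβ : -1 < β) (ha : α < β + 1) (j : ℕ) :
    ∫ x in Ioi (0 : ℝ), Lambda₂ (2 * β) (2 * α) j x * x ^ (2 * β + 1)
      = (-1) ^ j * 2 ^ (2 * β) * Real.Gamma (j + (β + 1 - α)) / j.factorial := by
  have hα : |α| < 2 * β + 2 - α := abs_lt.2 ⟨by linarith, by linarith⟩
  obtain ⟨g, hg, hgx⟩ := dominatedHolomorphic_complexMomentKernel hβ hα
  let D : ℝ × ℝ → ℂ := fun p => iteratedDeriv j (fun t => complexMomentKernel α β t p) 0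
  have hslice : ∀ᵐ x ∂volume.restrict (Ioi (0 : ℝ)),
      Lambda₂ (2 * β) (2 * α) j x * x ^ (2 * β + 1)
        = (∫ s in Ioi (0 : ℝ), D (x, s)).re / j.factorial := by
    filter_upwards [hgx, ae_restrict_mem measurableSet_Ioi] with x hd hx
    rw [← hd.iteratedDeriv_integral, ← iteratedDeriv_re_of_analyticAt
      (f := fun t => x ^ (2 * β + 1) * genG₂ (2 * β) (2 * α) t x) hd.analyticAt_integral,
      iteratedDeriv_const_mul_field, Lambda₂]
    · ring
    · filter_upwards [eventually_abs_lt_nhds_zero one_pos] with t ht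
      have ht' := (abs_lt.1 ht).2
      simp only [complexMomentKernel_ofReal α β ht']
      rw [integral_complex_ofReal, Complex.ofReal_re, ← genG₂_mul_rpow_eq_integral ht' hx,
        mul_comm]
  have hD : Integrable D quadrantMeasure := hg.integrable_iteratedDeriv j
  have hre : ∫ x in Ioi (0 : ℝ), (∫ s in Ioi (0 : ℝ), D (x, s)).re
      = (∫ p, D p ∂quadrantMeasure).re := by
    rw [quadrantMeasure, integral_prod D hD]
    exact integral_re (𝕜 := ℂ) hD.integral_prod_left
  rw [integral_congr_ae hslice, integral_div, hre, ← hg.iteratedDeriv_integral,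
    ← iteratedDeriv_re_of_analyticAt (f := fun t => 2 ^ (2 * β) *
      (Real.Gamma (β + 1 - α) * (1 + t) ^ (-(β + 1 - α)))) hg.analyticAt_integral,
    iteratedDeriv_const_mul_field, iteratedDeriv_Gamma_mul_one_add_rpow (by linarith)]
  · ring
  · filter_upwards [eventually_abs_lt_nhds_zero one_pos] with t ht
    simp only [complexMomentKernel_ofReal α β (abs_lt.1 ht).2]
    rw [integral_complex_ofReal, Complex.ofReal_re, integral_momentKernel hβ (by linarith) ht]

lemma besselK_neg (α z : ℝ) : besselK (-α) z = besselK α z := by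
  simp only [besselK, neg_mul, Real.cosh_neg]

lemma Lambda₂_mul_rpow (μ ν : ℝ) (j : ℕ) {x : ℝ} (hx : 0 < x) :
    Lambda₂ μ ν j x * x ^ ν = 2 ^ ν * Lambda₂ μ (-ν) j x := by
  have hG : (fun t => x ^ ν * genG₂ μ ν t x) =ᶠ[𝓝 0] fun t => 2 ^ ν * genG₂ μ (-ν) t x := by
    filter_upwards [eventually_abs_lt_nhds_zero one_pos] with t ht
    have ht' : 0 < 1 - t := by linarith [(abs_lt.1 ht).2]
    have e1 : (x / (1 - t) / 2) ^ (-(ν / 2)) * x ^ ν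
        = 2 ^ ν * (1 - t) ^ ν * (x / (1 - t) / 2) ^ (ν / 2) := by
      have hx' : x = 2 * (1 - t) * (x / (1 - t) / 2) := by field_simp
      have hz : 0 < x / (1 - t) / 2 := by positivity
      nth_rewrite 2 [hx']
      rw [Real.mul_rpow (by positivity) hz.le, Real.mul_rpow (by norm_num) ht'.le, mul_comm,
        mul_assoc, ← Real.rpow_add hz]
      congr 2
      ring
    have e2 : (1 - t) ^ (-(μ + -ν + 2) / 2) = (1 - t) ^ (-(μ + ν + 2) / 2) * (1 - t) ^ ν := by
      rw [← Real.rpow_add ht']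
      congr 1
      ring
    rw [genG₂, genG₂, tildeK, tildeK, neg_div 2 ν, besselK_neg, neg_neg, e2]
    linear_combination (1 - t) ^ (-(μ + ν + 2) / 2) * tildeI (μ / 2) (t * x / (1 - t)) *
      besselK (ν / 2) (x / (1 - t)) * e1
  have := hG.iteratedDeriv_eq j
  rw [iteratedDeriv_const_mul_field, iteratedDeriv_const_mul_field] at this
  rw [Lambda₂, Lambda₂]
  linear_combination this / j.factorial

/-- For `μ > −2`, `μ+ν > −2`, `μ−ν > −2` and every `j ∈ ℕ₀`:
`∫₀^∞ Λ_{2,j}^{μ,ν}(x)·x^{μ+1} dx = (−1)^j·2^μ·Γ(j+(μ−ν+2)/2)/j!` and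
`∫₀^∞ Λ_{2,j}^{μ,ν}(x)·x^{μ+ν+1} dx = (−1)^j·2^{μ+ν}·Γ(j+(μ+ν+2)/2)/j!`. -/
theorem statement19 (μ ν : ℝ) (hμ : -2 < μ) (h₁ : -2 < μ + ν) (h₂ : -2 < μ - ν) (j : ℕ) :
    (∫ x in Ioi (0 : ℝ), Lambda₂ μ ν j x * x ^ (μ + 1)
      = (-1) ^ j * 2 ^ μ * Real.Gamma ((j : ℝ) + (μ - ν + 2) / 2) / (j.factorial : ℝ)) ∧
    (∫ x in Ioi (0 : ℝ), Lambda₂ μ ν j x * x ^ (μ + ν + 1)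
      = (-1) ^ j * 2 ^ (μ + ν) * Real.Gamma ((j : ℝ) + (μ + ν + 2) / 2) / (j.factorial : ℝ)) := by
  have hΛ : ∀ κ : ℝ, -2 < μ - κ →
      ∫ x in Ioi (0 : ℝ), Lambda₂ μ κ j x * x ^ (μ + 1)
        = (-1) ^ j * 2 ^ μ * Real.Gamma ((j : ℝ) + (μ - κ + 2) / 2) / (j.factorial : ℝ) := by
    intro κ hκ
    have h := integral_Lambda₂_mul_rpow (α := κ / 2) (β := μ / 2) (by linarith) (by linarith) j
    rw [mul_div_cancel₀ μ two_ne_zero, mul_div_cancel₀ κ two_ne_zero] at h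
    rw [h, show μ / 2 + 1 - κ / 2 = (μ - κ + 2) / 2 by ring]
  refine ⟨hΛ ν h₂, ?_⟩
  have hrefl : ∀ x ∈ Ioi (0 : ℝ), Lambda₂ μ ν j x * x ^ (μ + ν + 1)
      = 2 ^ ν * (Lambda₂ μ (-ν) j x * x ^ (μ + 1)) := by
    intro x hx
    rw [show μ + ν + 1 = ν + (μ + 1) by ring, Real.rpow_add hx, ← mul_assoc,
      Lambda₂_mul_rpow μ ν j hx, mul_assoc]
  rw [setIntegral_congr_fun measurableSet_Ioi hrefl, integral_const_mul,
    hΛ (-ν) (by linarith), sub_neg_eq_add, Real.rpow_add two_pos]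
  ring
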